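/- In the degenerating setup, assume in addition that q_{d₁+1}, …, q_e are pairwise distinct. Then for each k with d₁ < k ≤ e there exists ε₀ > 0 such that for every ε ∈ (0, ε₀) there is N with the following property: for every n ≥ N, the derivative B_n' has exactly one zero c in the set {z ∈ 𝔻 : |z − q_k| < ε}, and this zero is simple, i.e. B_n''(c) ≠ 0. -/

import Mathlib

open Filter

/-- The Blaschke product with exponent `m` and zero list `a : Fin e → ℂ`. -/
noncomputable def blaschke (m : ℕ) {e : ℕ} (a : Fin e → ℂ) (z : ℂ) : ℂ :=
  z ^ m * ∏ k, ((1 - (starRingEnd ℂ) (a k)) / (1 - a k) *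
    ((z - a k) / (1 - (starRingEnd ℂ) (a k) * z)))


lemma core1 (S : ℂ → ℂ) (ρ R β ε τ : ℝ) (hρ : 0 < ρ)
    (hε : 0 < ε) (hερ : ε < ρ / 2)
    (hS : ∀ s, ‖s‖ < ρ → DifferentiableAt ℂ S s)
    (hR : ∀ s, ‖s‖ < ρ → ‖S s‖ ≤ R) (hre : ∀ s, ‖s‖ < ρ → β ≤ (S s).re)
    (hτ : 0 < τ) (h1 : τ * R < ε) (h2 : τ * (R / (ρ / 4)) ≤ 1 / 2) (h3 : τ * R ^ 2 < 2 * β) :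
    ∃ c : ℂ, ‖c‖ < ε ∧ ‖1 - c‖ < 1 ∧ c = τ * S c ∧ τ * deriv S c ≠ 1 ∧
      ∀ c' : ℂ, ‖c'‖ < ρ / 2 → c' = τ * S c' → c' = c := by
  have hder : ∀ s, ‖s‖ < ρ / 2 → ‖deriv S s‖ ≤ R / (ρ / 4) := by
    intro s hs
    have hmem : ∀ w ∈ Metric.closedBall s (ρ / 4), ‖w‖ < ρ := by
      intro w hw
      rw [mem_closedBall_iff_norm] at hw
      have := norm_le_norm_add_norm_sub s w
      have h := norm_sub_rev s w
      linarith
    apply Complex.norm_deriv_le_of_forall_mem_sphere_norm_le (by positivity)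
    · apply DifferentiableOn.diffContOnCl_ball (U := Metric.closedBall s (ρ / 4))
      · exact fun w hw => (hS w (hmem w hw)).differentiableWithinAt
      · exact subset_rfl
    · exact fun w hw => hR w (hmem w (Metric.sphere_subset_closedBall hw))
  let f : ℂ → ℂ := fun s => τ * S s
  have hfd : ∀ s ∈ Metric.ball (0 : ℂ) (ρ / 2), DifferentiableAt ℂ f s := by
    intro s hs
    rw [mem_ball_zero_iff] at hs
    exact (hS s (by linarith)).const_mul _
  have hfb : ∀ s ∈ Metric.ball (0 : ℂ) (ρ / 2), ‖deriv f s‖ ≤ 1 / 2 := by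
    intro s hs
    rw [mem_ball_zero_iff] at hs
    have : deriv f s = τ * deriv S s := by
      simp [f]
    rw [this, norm_mul, Complex.norm_real, Real.norm_of_nonneg hτ.le]
    exact le_trans (mul_le_mul_of_nonneg_left (hder s hs) hτ.le) h2
  have hlip : LipschitzOnWith (1 / 2) f (Metric.ball (0 : ℂ) (ρ / 2)) := by
    apply Convex.lipschitzOnWith_of_nnnorm_deriv_le hfd _ (convex_ball _ _)
    intro s hs
    have := hfb s hs
    rw [← NNReal.coe_le_coe]
    simpa using this
  have hfn : ∀ s, ‖s‖ < ρ → ‖f s‖ ≤ τ * R := by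
    intro s hs
    simp only [f]
    rw [norm_mul, Complex.norm_real, Real.norm_of_nonneg hτ.le]
    exact mul_le_mul_of_nonneg_left (hR s hs) hτ.le
  have hsub : Metric.closedBall (0 : ℂ) ε ⊆ Metric.ball 0 (ρ / 2) :=
    Metric.closedBall_subset_ball hερ
  have hmaps : Set.MapsTo f (Metric.closedBall (0 : ℂ) ε) (Metric.closedBall (0 : ℂ) ε) := by
    intro s hs
    rw [mem_closedBall_zero_iff] at *
    exact (hfn s (by linarith)).trans h1.le
  have hcon : ContractingWith (1 / 2) (hmaps.restrict f _ _) := by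
    refine ⟨?_, ?_⟩
    · rw [← NNReal.coe_lt_coe]; norm_num
    · intro x y
      exact hlip (hsub x.2) (hsub y.2)
  obtain ⟨c, hc, hfix, -⟩ := hcon.exists_fixedPoint' Metric.isClosed_closedBall.isComplete hmaps
    (Metric.mem_closedBall_self hε.le) (edist_ne_top _ _)
  have hfix' : f c = c := hfix
  have hcb := hsub hc
  have hcρ : ‖c‖ < ρ := by
    rw [mem_ball_zero_iff] at hcb; linarith
  have hcn : ‖c‖ ≤ τ * R := by
    have := hfn c hcρ
    rwa [hfix'] at this
  refine ⟨c, lt_of_le_of_lt hcn h1, ?_, hfix'.symm, ?_, ?_⟩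
  · have hcre : τ * β ≤ c.re := by
      have h := hre c hcρ
      rw [← hfix']
      simp only [f, Complex.re_ofReal_mul]
      exact mul_le_mul_of_nonneg_left h hτ.le
    have h4 : ‖1 - c‖ ^ 2 = 1 - 2 * c.re + ‖c‖ ^ 2 := by
      rw [← Complex.normSq_eq_norm_sq, ← Complex.normSq_eq_norm_sq, Complex.normSq_apply,
        Complex.normSq_apply]
      simp
      ring
    have h5 : ‖c‖ ^ 2 ≤ (τ * R) ^ 2 := pow_le_pow_left₀ (norm_nonneg _) hcn 2
    have h6 : τ * (τ * R ^ 2) < τ * (2 * β) := mul_lt_mul_of_pos_left h3 hτ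
    have h7 : ‖1 - c‖ ^ 2 < 1 := by nlinarith
    exact (sq_lt_one_iff₀ (norm_nonneg _)).1 h7
  · intro h
    have h8 := hfb c hcb
    have : deriv f c = τ * deriv S c := by simp [f]
    rw [this, h] at h8
    norm_num at h8
  · intro c' hc' hfc'
    have h9 := hlip.dist_le_mul c' (mem_ball_zero_iff.2 hc') c hcb
    have h10 : f c' = c' := hfc'.symm
    rw [hfix', h10] at h9
    have : dist c' c = 0 := by
      have := dist_nonneg (x := c') (y := c)
      norm_num at h9
      linarith
    exact dist_eq_zero.1 this

lemma core2 (ν ρ ε : ℝ) (hν : 0 < ν) (hρ : 0 < ρ) (hε : 0 < ε) (hερ : ε < ρ / 2) :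
    ∃ T > (0 : ℝ), ∀ t : ℝ, 0 < t → t < T → ∀ H : ℂ → ℂ,
      (∀ s, ‖s‖ < ρ → DifferentiableAt ℂ H s) →
      (∀ s, ‖s‖ < ρ → ‖H s - ν‖ < ν / 2) →
      ∃ c : ℂ, ‖c‖ < ε ∧ ‖1 - c‖ < 1 ∧ t * H c - c ^ 2 = 0 ∧ t * deriv H c - 2 * c ≠ 0 ∧
        ∀ c' : ℂ, ‖c'‖ < ρ / 2 → ‖1 - c'‖ < 1 → t * H c' - c' ^ 2 = 0 → c' = c := by
  obtain ⟨R, hR0, hR⟩ : ∃ R : ℝ, 0 < R ∧ 3 * ν / 2 ≤ R ^ 2 :=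
    ⟨√(2 * ν), by positivity, by rw [Real.sq_sqrt (by positivity)]; linarith⟩
  obtain ⟨β, hβ0, hβ⟩ : ∃ β : ℝ, 0 < β ∧ β ^ 2 ≤ ν / 2 :=
    ⟨√(ν / 2), by positivity, by rw [Real.sq_sqrt (by positivity)]⟩
  have hlim : ∀ K > (0 : ℝ), ∀ x : ℝ, ∀ᶠ τ in nhds (0 : ℝ), τ * x < K := by
    intro K hK x
    have : Tendsto (fun τ : ℝ => τ * x) (nhds 0) (nhds (0 * x)) :=
      (continuous_id.mul continuous_const).tendsto 0
    rw [zero_mul] at this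
    exact this.eventually_lt_const hK
  have hev : ∀ᶠ τ in nhds (0 : ℝ), τ * R < ε ∧ τ * (R / (ρ / 4)) < 1 / 2 ∧ τ * R ^ 2 < 2 * β :=
    (hlim _ hε _).and ((hlim _ (by norm_num) _).and (hlim _ (by positivity) _))
  obtain ⟨T, hT, hT'⟩ := Metric.eventually_nhds_iff.1 hev
  refine ⟨T ^ 2, by positivity, ?_⟩
  intro t ht htT H hHd hHb
  obtain ⟨τ, hτ, hτt, hτT⟩ : ∃ τ : ℝ, 0 < τ ∧ τ ^ 2 = t ∧ τ < T := by
    refine ⟨√t, by positivity, Real.sq_sqrt ht.le, ?_⟩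
    exact (Real.sqrt_lt' hT).2 htT
  have hh := hT' (y := τ) (by simpa [abs_of_pos hτ] using hτT)
  have hHre : ∀ s, ‖s‖ < ρ → ν / 2 < (H s).re := by
    intro s hs
    have h1 := hHb s hs
    have h2 := Complex.abs_re_le_norm (H s - ν)
    simp at h2
    have := neg_abs_le ((H s).re - ν)
    linarith
  let S : ℂ → ℂ := fun s => Complex.exp (Complex.log (H s) / 2)
  have hH0 : ∀ s, ‖s‖ < ρ → H s ≠ 0 := by
    intro s hs h
    have := hHre s hs
    rw [h] at this
    simp at this
    linarith
  have hSH : ∀ s, ‖s‖ < ρ → S s ^ 2 = H s := by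
    intro s hs
    simp only [S]
    rw [← Complex.exp_nat_mul]
    push_cast
    rw [mul_div_cancel₀ _ (by norm_num), Complex.exp_log (hH0 s hs)]
  have hSd : ∀ s, ‖s‖ < ρ → DifferentiableAt ℂ S s := by
    intro s hs
    apply DifferentiableAt.cexp
    apply DifferentiableAt.div_const
    apply (hHd s hs).clog
    left
    have := hHre s hs
    linarith
  have hSpos : ∀ s, ‖s‖ < ρ → 0 < (S s).re := by
    intro s hs
    simp only [S, Complex.exp_re]
    apply mul_pos (Real.exp_pos _)
    have h1 : (Complex.log (H s) / 2).im = (H s).arg / 2 := by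
      simp [Complex.log_im]
    rw [h1]
    have := Complex.abs_arg_lt_pi_div_two_iff.2 (Or.inl (by linarith [hHre s hs] : 0 < (H s).re))
    rw [abs_lt] at this
    apply Real.cos_pos_of_mem_Ioo
    constructor <;> linarith [Real.pi_pos]
  have hSR : ∀ s, ‖s‖ < ρ → ‖S s‖ ≤ R := by
    intro s hs
    have h1 : ‖S s‖ ^ 2 = ‖H s‖ := by rw [← norm_pow, hSH s hs]
    have h2 : ‖H s‖ ≤ 3 * ν / 2 := by
      have h3 := norm_sub_norm_le (H s) ν
      have h4 := hHb s hs
      rw [Complex.norm_real, Real.norm_of_nonneg hν.le] at h3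
      linarith
    refine (sq_le_sq₀ (by positivity) (by positivity)).1 ?_
    linarith
  have hSβ : ∀ s, ‖s‖ < ρ → β ≤ (S s).re := by
    intro s hs
    refine (sq_le_sq₀ (by positivity) (hSpos s hs).le).1 ?_
    have h1 := hHre s hs
    rw [← hSH s hs] at h1
    simp [sq] at h1
    nlinarith [mul_self_nonneg (S s).im]
  obtain ⟨c, hc1, hc2, hc3, hc4, hc5⟩ := core1 S ρ R β ε τ hρ hε hερ hSd hSR hSβ hτ hh.1
    hh.2.1.le hh.2.2
  have hcρ : ‖c‖ < ρ := by linarith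
  have htc : (t : ℂ) = (τ : ℂ) ^ 2 := by rw [← hτt]; push_cast; rfl
  have hre : ∀ c : ℂ, ‖1 - c‖ < 1 → 0 < c.re := by
    intro c hc
    have := (Complex.re_le_norm (1 - c)).trans_lt hc
    simp at this
    exact this
  refine ⟨c, hc1, hc2, ?_, ?_, ?_⟩
  · rw [← hSH c hcρ, htc]
    nth_rewrite 2 [hc3]
    ring
  · have hd : deriv H c = 2 * S c * deriv S c := by
      have h1 : (fun s => S s ^ 2) =ᶠ[nhds c] H := by
        have : ∀ᶠ s in nhds c, ‖s‖ < ρ := continuous_norm.continuousAt.eventually_lt_const hcρ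
        filter_upwards [this] with s hs using hSH s hs
      rw [← h1.deriv_eq]
      have := ((hSd c hcρ).hasDerivAt.fun_pow 2).deriv
      simpa using this
    rw [hd, htc]
    intro h
    have h2 : 2 * c * (τ * deriv S c - 1) = 0 := by
      linear_combination h + 2 * τ * deriv S c * hc3
    have hc0 : c ≠ 0 := by
      rintro rfl
      have := hre 0 hc2
      simp at this
    rcases mul_eq_zero.1 h2 with h3 | h3
    · exact hc0 (by simpa using h3)
    · exact hc4 (sub_eq_zero.1 h3)
  · intro c' h1 h2 h3
    apply hc5 c' h1
    have hc'ρ : ‖c'‖ < ρ := by linarith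
    rw [← hSH c' hc'ρ, htc] at h3
    have h4 : (c' - τ * S c') * (c' + τ * S c') = 0 := by linear_combination -h3
    rcases mul_eq_zero.1 h4 with h5 | h5
    · exact sub_eq_zero.1 h5
    · exfalso
      have h6 := congrArg Complex.re h5
      simp at h6
      have h7 := hre c' h2
      have h8 := mul_pos hτ (hSpos c' hc'ρ)
      linarith

noncomputable def Lf (m : ℕ) {e : ℕ} (k : Fin e) (b : Fin e → ℂ) (z : ℂ) : ℂ :=
  m / z + ∑ j ∈ Finset.univ.erase k, (1 - b j * (starRingEnd ℂ) (b j)) /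
    ((z - b j) * (1 - (starRingEnd ℂ) (b j) * z))

noncomputable def Gf (m : ℕ) {e : ℕ} (k : Fin e) (b : Fin e → ℂ) (z : ℂ) : ℂ :=
  z ^ m * ∏ j ∈ Finset.univ.erase k, ((1 - (starRingEnd ℂ) (b j)) / (1 - b j) *
    ((z - b j) / (1 - (starRingEnd ℂ) (b j) * z)))

noncomputable def uf {e : ℕ} (k : Fin e) (b : Fin e → ℂ) : ℂ := b k / (‖b k‖ : ℂ)

noncomputable def Zf {e : ℕ} (k : Fin e) (b : Fin e → ℂ) (s : ℂ) : ℂ := uf k b * (1 - s)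

noncomputable def Hf (m : ℕ) {e : ℕ} (k : Fin e) (b : Fin e → ℂ) (s : ℂ) : ℂ :=
  ((1 - ‖b k‖) - (1 - ‖b k‖) * s + (1 + ‖b k‖) / (uf k b * Lf m k b (Zf k b s))) / ‖b k‖

noncomputable def Qf (m : ℕ) {e : ℕ} (k : Fin e) (b : Fin e → ℂ) (s : ℂ) : ℂ :=
  ((1 - (starRingEnd ℂ) (b k)) / (1 - b k)) * Gf m k b (Zf k b s) /
    (1 - (starRingEnd ℂ) (b k) * Zf k b s) ^ 2 * (uf k b * Lf m k b (Zf k b s)) * ‖b k‖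

/-- conditions on a point -/
def Good {e : ℕ} (k : Fin e) (b : Fin e → ℂ) (z : ℂ) : Prop :=
  z ≠ 0 ∧ ∀ j ≠ k, z - b j ≠ 0 ∧ 1 - (starRingEnd ℂ) (b j) * z ≠ 0

lemma one_sub_ne {w : ℂ} (h : ‖w‖ < 1) : 1 - w ≠ 0 := by
  intro h0
  have : w = 1 := (sub_eq_zero.1 h0).symm
  rw [this] at h
  simp at h

lemma one_sub_conj_ne {w z : ℂ} (h : ‖w‖ < 1) (hz : ‖z‖ < 1) :
    1 - (starRingEnd ℂ) w * z ≠ 0 := by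
  apply one_sub_ne
  rw [norm_mul, RCLike.norm_conj]
  nlinarith [norm_nonneg w, norm_nonneg z]

lemma Gf_diff (m : ℕ) {e : ℕ} (k : Fin e) (b : Fin e → ℂ) (z : ℂ) (hg : Good k b z) :
    DifferentiableAt ℂ (Gf m k b) z := by
  unfold Gf
  apply DifferentiableAt.mul (by fun_prop)
  apply DifferentiableAt.fun_finsetProd
  intro j hj
  have := (hg.2 j (Finset.ne_of_mem_erase hj)).2
  fun_prop (disch := assumption)

lemma Lf_diff (m : ℕ) {e : ℕ} (k : Fin e) (b : Fin e → ℂ) (z : ℂ) (hg : Good k b z) :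
    DifferentiableAt ℂ (Lf m k b) z := by
  unfold Lf
  have h0 := hg.1
  apply DifferentiableAt.add
  · fun_prop (disch := assumption)
  apply DifferentiableAt.fun_sum
  intro j hj
  have := mul_ne_zero (hg.2 j (Finset.ne_of_mem_erase hj)).1 (hg.2 j (Finset.ne_of_mem_erase hj)).2
  fun_prop (disch := assumption)

lemma Gf_ne (m : ℕ) {e : ℕ} (k : Fin e) (b : Fin e → ℂ) (hb : ∀ j, ‖b j‖ < 1) (z : ℂ)
    (hg : Good k b z) : Gf m k b z ≠ 0 := by
  unfold Gf
  apply mul_ne_zero (pow_ne_zero _ hg.1)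
  rw [Finset.prod_ne_zero_iff]
  intro j hj
  have h := hg.2 j (Finset.ne_of_mem_erase hj)
  have h1 := one_sub_ne (hb j)
  have h2 : 1 - (starRingEnd ℂ) (b j) ≠ 0 := one_sub_ne (by simpa using hb j)
  exact mul_ne_zero (div_ne_zero h2 h1) (div_ne_zero h.1 h.2)

lemma phi_deriv (a z : ℂ) (h : 1 - (starRingEnd ℂ) a * z ≠ 0) :
    HasDerivAt (fun z => (z - a) / (1 - (starRingEnd ℂ) a * z))
      ((1 - a * (starRingEnd ℂ) a) / (1 - (starRingEnd ℂ) a * z) ^ 2) z := by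
  have h1 : HasDerivAt (fun z : ℂ => z - a) 1 z := (hasDerivAt_id z).sub_const a
  have h2 : HasDerivAt (fun z : ℂ => 1 - (starRingEnd ℂ) a * z) (-((starRingEnd ℂ) a * 1)) z :=
    ((hasDerivAt_id z).const_mul _).const_sub 1
  convert! h1.div h2 h using 1
  congr 1
  ring

lemma Gf_deriv (m : ℕ) {e : ℕ} (k : Fin e) (b : Fin e → ℂ) (hb : ∀ j, ‖b j‖ < 1) (z : ℂ)
    (hg : Good k b z) : deriv (Gf m k b) z = Gf m k b z * Lf m k b z := by
  have hG := Gf_ne m k b hb z hg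
  have hfac : ∀ j ∈ Finset.univ.erase k, ((1 - (starRingEnd ℂ) (b j)) / (1 - b j) *
    ((z - b j) / (1 - (starRingEnd ℂ) (b j) * z))) ≠ 0 := by
    intro j hj
    have h := hg.2 j (Finset.ne_of_mem_erase hj)
    have h1 := one_sub_ne (hb j)
    have h2 : 1 - (starRingEnd ℂ) (b j) ≠ 0 := one_sub_ne (by simpa using hb j)
    exact mul_ne_zero (div_ne_zero h2 h1) (div_ne_zero h.1 h.2)
  have hd : ∀ j ∈ Finset.univ.erase k, DifferentiableAt ℂ (fun z => (1 - (starRingEnd ℂ) (b j)) / (1 - b j) *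
    ((z - b j) / (1 - (starRingEnd ℂ) (b j) * z))) z := by
    intro j hj
    have := (hg.2 j (Finset.ne_of_mem_erase hj)).2
    fun_prop (disch := assumption)
  have h1 : logDeriv (Gf m k b) z = Lf m k b z := by
    unfold Gf
    rw [logDeriv_mul (f := fun z => z ^ m) z (pow_ne_zero _ hg.1) (Finset.prod_ne_zero_iff.2 hfac) (by fun_prop)
      (DifferentiableAt.fun_finsetProd hd), logDeriv_prod hfac hd, logDeriv_pow]
    unfold Lf
    congr 1
    apply Finset.sum_congr rfl
    intro j hj
    have h := hg.2 j (Finset.ne_of_mem_erase hj)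
    have h1 := one_sub_ne (hb j)
    have h2 : 1 - (starRingEnd ℂ) (b j) ≠ 0 := one_sub_ne (by simpa using hb j)
    rw [logDeriv_const_mul _ _ (div_ne_zero h2 h1), logDeriv_apply, (phi_deriv _ _ h.2).deriv]
    have h3 := h.1
    have h4 := h.2
    field_simp
  rw [logDeriv_apply, div_eq_iff hG] at h1
  rw [h1, mul_comm]

lemma blaschke_deriv (m : ℕ) {e : ℕ} (k : Fin e) (b : Fin e → ℂ) (hb : ∀ j, ‖b j‖ < 1) (z : ℂ)
    (hz : ‖z‖ < 1) (hg : Good k b z) : deriv (blaschke m b) z =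
      ((1 - (starRingEnd ℂ) (b k)) / (1 - b k)) * Gf m k b z /
        (1 - (starRingEnd ℂ) (b k) * z) ^ 2 *
      (Lf m k b z * ((z - b k) * (1 - (starRingEnd ℂ) (b k) * z)) +
        (1 - b k * (starRingEnd ℂ) (b k))) := by
  have hB : blaschke m b = fun z => ((1 - (starRingEnd ℂ) (b k)) / (1 - b k)) *
      (Gf m k b z * ((z - b k) / (1 - (starRingEnd ℂ) (b k) * z))) := by
    funext z
    unfold blaschke Gf
    rw [← Finset.mul_prod_erase Finset.univ (fun k => (1 - (starRingEnd ℂ) (b k)) / (1 - b k) *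
      ((z - b k) / (1 - (starRingEnd ℂ) (b k) * z))) (Finset.mem_univ k)]
    ring
  have hk := one_sub_conj_ne (hb k) hz
  rw [hB]
  have hd := (((Gf_diff m k b z hg).hasDerivAt.mul (phi_deriv (b k) z hk)).const_mul
    ((1 - (starRingEnd ℂ) (b k)) / (1 - b k))).deriv
  rw [Gf_deriv m k b hb z hg] at hd
  refine Eq.trans hd ?_
  field_simp

lemma uf_norm {e : ℕ} (k : Fin e) (b : Fin e → ℂ) (h0 : b k ≠ 0) : ‖uf k b‖ = 1 := by
  unfold uf
  rw [norm_div, Complex.norm_real, norm_norm, div_self (norm_ne_zero_iff.2 h0)]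

lemma bridge (m : ℕ) {e : ℕ} (k : Fin e) (b : Fin e → ℂ) (hb : ∀ j, ‖b j‖ < 1) (h0 : b k ≠ 0)
    (s : ℂ) (hs : ‖1 - s‖ < 1) (hg : Good k b (Zf k b s)) (hL : Lf m k b (Zf k b s) ≠ 0) :
    deriv (blaschke m b) (Zf k b s) =
      Qf m k b s * (((1 - ‖b k‖ : ℝ) : ℂ) * Hf m k b s - s ^ 2) := by
  have hu := uf_norm k b h0
  have hz : ‖Zf k b s‖ < 1 := by
    unfold Zf; rw [norm_mul, hu, one_mul]; exact hs
  have hu0 : uf k b ≠ 0 := norm_ne_zero_iff.1 (by rw [hu]; norm_num)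
  have hr : (‖b k‖ : ℂ) ≠ 0 := by exact_mod_cast norm_ne_zero_iff.2 h0
  rw [blaschke_deriv m k b hb _ hz hg]
  unfold Qf
  have hbk : b k = uf k b * ‖b k‖ := by unfold uf; field_simp
  have huu : uf k b * (starRingEnd ℂ) (uf k b) = 1 := by
    rw [Complex.mul_conj, Complex.normSq_eq_norm_sq, hu]; simp
  have hcb : (starRingEnd ℂ) (b k) = (starRingEnd ℂ) (uf k b) * ‖b k‖ := by
    nth_rewrite 1 [hbk]
    simp
  have key : Lf m k b (Zf k b s) * ((Zf k b s - b k) * (1 - (starRingEnd ℂ) (b k) * Zf k b s)) +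
        (1 - b k * (starRingEnd ℂ) (b k)) = (uf k b * Lf m k b (Zf k b s)) * ‖b k‖ *
        (((1 - ‖b k‖ : ℝ) : ℂ) * Hf m k b s - s ^ 2) := by
    have hH : ‖b k‖ * (uf k b * Lf m k b (Zf k b s)) * Hf m k b s =
      ((1 - ‖b k‖) - (1 - ‖b k‖) * s) * (uf k b * Lf m k b (Zf k b s)) + (1 + ‖b k‖) := by
      unfold Hf
      field_simp
    have e1 : Zf k b s - b k = uf k b * (1 - s - ‖b k‖) := by
      unfold Zf
      linear_combination -hbk
    have e2 : 1 - (starRingEnd ℂ) (b k) * Zf k b s = 1 - ‖b k‖ * (1 - s) := by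
      rw [hcb]; unfold Zf
      linear_combination -(‖b k‖ * (1 - s)) * huu
    have e3 : 1 - b k * (starRingEnd ℂ) (b k) = 1 - (‖b k‖ : ℂ) ^ 2 := by
      rw [Complex.mul_conj, Complex.normSq_eq_norm_sq]; simp
    rw [e1, e2, e3]
    push_cast
    linear_combination -(1 - (‖b k‖ : ℂ)) * hH
  rw [key]
  ring

lemma Zf_diff {e : ℕ} (k : Fin e) (b : Fin e → ℂ) (s : ℂ) : DifferentiableAt ℂ (Zf k b) s := by
  unfold Zf; fun_prop

lemma LZ_diff (m : ℕ) {e : ℕ} (k : Fin e) (b : Fin e → ℂ) (s : ℂ) (hg : Good k b (Zf k b s)) :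
    DifferentiableAt ℂ (fun s => Lf m k b (Zf k b s)) s :=
  (Lf_diff m k b _ hg).comp s (Zf_diff k b s)

lemma Hf_diff (m : ℕ) {e : ℕ} (k : Fin e) (b : Fin e → ℂ) (h0 : b k ≠ 0)
    (s : ℂ) (hg : Good k b (Zf k b s)) (hL : Lf m k b (Zf k b s) ≠ 0) :
    DifferentiableAt ℂ (Hf m k b) s := by
  have hu : uf k b ≠ 0 := norm_ne_zero_iff.1 (by rw [uf_norm k b h0]; norm_num)
  have h1 := LZ_diff m k b s hg
  have h2 := mul_ne_zero hu hL
  unfold Hf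
  apply DifferentiableAt.div_const
  apply DifferentiableAt.add (by fun_prop)
  apply DifferentiableAt.div (by fun_prop) (h1.const_mul _) h2

lemma Qf_diff (m : ℕ) {e : ℕ} (k : Fin e) (b : Fin e → ℂ) (hb : ∀ j, ‖b j‖ < 1) (h0 : b k ≠ 0)
    (s : ℂ) (hs : ‖1 - s‖ < 1) (hg : Good k b (Zf k b s)) :
    DifferentiableAt ℂ (Qf m k b) s := by
  have hz : ‖Zf k b s‖ < 1 := by
    unfold Zf; rw [norm_mul, uf_norm k b h0, one_mul]; exact hs
  have h1 := LZ_diff m k b s hg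
  have h2 : DifferentiableAt ℂ (fun s => Gf m k b (Zf k b s)) s :=
    (Gf_diff m k b _ hg).comp s (Zf_diff k b s)
  have h3 := pow_ne_zero 2 (one_sub_conj_ne (hb k) hz)
  have h4 := Zf_diff k b s
  unfold Qf
  apply DifferentiableAt.mul_const
  apply DifferentiableAt.mul
  · apply DifferentiableAt.div (h2.const_mul _) _ h3
    exact ((h4.const_mul _).const_sub 1).pow 2
  · exact h1.const_mul _

lemma Qf_ne (m : ℕ) {e : ℕ} (k : Fin e) (b : Fin e → ℂ) (hb : ∀ j, ‖b j‖ < 1) (h0 : b k ≠ 0)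
    (s : ℂ) (hs : ‖1 - s‖ < 1) (hg : Good k b (Zf k b s)) (hL : Lf m k b (Zf k b s) ≠ 0) :
    Qf m k b s ≠ 0 := by
  have hz : ‖Zf k b s‖ < 1 := by
    unfold Zf; rw [norm_mul, uf_norm k b h0, one_mul]; exact hs
  have hu : uf k b ≠ 0 := norm_ne_zero_iff.1 (by rw [uf_norm k b h0]; norm_num)
  have h1 := one_sub_ne (hb k)
  have h2 : 1 - (starRingEnd ℂ) (b k) ≠ 0 := one_sub_ne (by simpa using hb k)
  have h3 := pow_ne_zero 2 (one_sub_conj_ne (hb k) hz)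
  have hr : (‖b k‖ : ℂ) ≠ 0 := by exact_mod_cast norm_ne_zero_iff.2 h0
  unfold Qf
  exact mul_ne_zero (mul_ne_zero (div_ne_zero (mul_ne_zero (div_ne_zero h2 h1)
    (Gf_ne m k b hb _ hg)) h3) (mul_ne_zero hu hL)) hr

lemma deriv2_ne (m : ℕ) {e : ℕ} (k : Fin e) (b : Fin e → ℂ) (hb : ∀ j, ‖b j‖ < 1) (h0 : b k ≠ 0)
    (ρ : ℝ) (hgood : ∀ s, ‖s‖ < ρ → Good k b (Zf k b s) ∧ Lf m k b (Zf k b s) ≠ 0)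
    (c : ℂ) (hcρ : ‖c‖ < ρ) (hc : ‖1 - c‖ < 1)
    (hf : ((1 - ‖b k‖ : ℝ) : ℂ) * Hf m k b c - c ^ 2 = 0)
    (hf' : ((1 - ‖b k‖ : ℝ) : ℂ) * deriv (Hf m k b) c - 2 * c ≠ 0) :
    deriv (deriv (blaschke m b)) (Zf k b c) ≠ 0 := by
  have hu : uf k b ≠ 0 := norm_ne_zero_iff.1 (by rw [uf_norm k b h0]; norm_num)
  obtain ⟨hg, hL⟩ := hgood c hcρ
  have hQ := (Qf_diff m k b hb h0 c hc hg).hasDerivAt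
  have hH := (Hf_diff m k b h0 c hg hL).hasDerivAt
  have hF : HasDerivAt (fun s => ((1 - ‖b k‖ : ℝ) : ℂ) * Hf m k b s - s ^ 2)
      (((1 - ‖b k‖ : ℝ) : ℂ) * deriv (Hf m k b) c - 2 * c) c := by
    have := (hH.const_mul ((1 - ‖b k‖ : ℝ) : ℂ)).fun_sub (hasDerivAt_pow 2 c)
    simpa using this
  have hP := hQ.mul hF
  rw [hf, mul_zero, zero_add] at hP
  have hev : (fun s => deriv (blaschke m b) (Zf k b s)) =ᶠ[nhds c]
      (Qf m k b * fun s => ((1 - ‖b k‖ : ℝ) : ℂ) * Hf m k b s - s ^ 2) := by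
    have e1 : ∀ᶠ s in nhds c, ‖s‖ < ρ := continuous_norm.continuousAt.eventually_lt_const hcρ
    have e2 : ∀ᶠ s : ℂ in nhds c, ‖1 - s‖ < 1 :=
      (by fun_prop : ContinuousAt (fun s : ℂ => ‖1 - s‖) c).eventually_lt_const hc
    filter_upwards [e1, e2] with s h1 h2
    exact bridge m k b hb h0 s h2 (hgood s h1).1 (hgood s h1).2
  have hg' := hP.congr_of_eventuallyEq hev
  have hinv : HasDerivAt (fun z : ℂ => 1 - z / uf k b) (-(1 / uf k b)) (Zf k b c) :=
    ((hasDerivAt_id _).div_const _).const_sub 1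
  have hpt : (fun z : ℂ => 1 - z / uf k b) (Zf k b c) = c := by
    simp only [Zf]; field_simp; ring
  rw [← hpt] at hg'
  have hcomp := hg'.comp (Zf k b c) hinv
  have hfun : ((fun s => deriv (blaschke m b) (Zf k b s)) ∘ fun z : ℂ => 1 - z / uf k b) =
      deriv (blaschke m b) := by
    funext z
    simp only [Function.comp, Zf]
    congr 1
    field_simp
    ring
  rw [hfun] at hcomp
  rw [hcomp.deriv, hpt]
  exact mul_ne_zero (mul_ne_zero (Qf_ne m k b hb h0 c hc hg hL) hf')
    (neg_ne_zero.2 (one_div_ne_zero hu))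

lemma local_facts (m : ℕ) (hm : 1 ≤ m) {e : ℕ} (k : Fin e) (q : Fin e → ℂ)
    (hq : ∀ j, ‖q j‖ ≤ 1) (hqk : ‖q k‖ = 1) (hne : ∀ j ≠ k, q k ≠ q j) :
    ∃ ν > (0 : ℝ), ∀ᶠ p : (Fin e → ℂ) × ℂ in nhds (q, 0),
      p.1 k ≠ 0 ∧ Good k p.1 (Zf k p.1 p.2) ∧ Lf m k p.1 (Zf k p.1 p.2) ≠ 0 ∧
        ‖Hf m k p.1 p.2 - ν‖ < ν / 2 := by
  have hk0 : q k ≠ 0 := norm_ne_zero_iff.1 (by rw [hqk]; norm_num)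
  have hkk : q k * (starRingEnd ℂ) (q k) = 1 := by
    rw [Complex.mul_conj, Complex.normSq_eq_norm_sq, hqk]; simp
  have hconj : ∀ j, 1 - (starRingEnd ℂ) (q j) * q k = q k * (starRingEnd ℂ) (q k - q j) := by
    intro j
    rw [map_sub]
    linear_combination -hkk
  have hne1 : ∀ j ≠ k, q k - q j ≠ 0 := fun j hj => sub_ne_zero.2 (hne j hj)
  have hne2 : ∀ j ≠ k, 1 - (starRingEnd ℂ) (q j) * q k ≠ 0 := by
    intro j hj
    rw [hconj]
    exact mul_ne_zero hk0 ((map_ne_zero _).2 (hne1 j hj))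
  have hu : uf k q = q k := by simp [uf, hqk]
  have hZ : Zf k q 0 = q k := by simp [Zf, hu]
  -- the value of the logarithmic derivative
  obtain ⟨μ, hμ, hLμ⟩ : ∃ μ : ℝ, 0 < μ ∧ q k * Lf m k q (q k) = μ := by
    refine ⟨m + ∑ j ∈ Finset.univ.erase k, (1 - ‖q j‖ ^ 2) / ‖q k - q j‖ ^ 2, ?_, ?_⟩
    · have h1 : (0 : ℝ) < m := by exact_mod_cast hm
      have h2 : 0 ≤ ∑ j ∈ Finset.univ.erase k, (1 - ‖q j‖ ^ 2) / ‖q k - q j‖ ^ 2 := by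
        apply Finset.sum_nonneg
        intro j _
        apply div_nonneg _ (by positivity)
        nlinarith [hq j, norm_nonneg (q j)]
      linarith
    · unfold Lf
      push_cast
      rw [mul_add, mul_div_cancel₀ _ hk0, Finset.mul_sum]
      congr 1
      apply Finset.sum_congr rfl
      intro j hj
      have h1 := hne1 j (Finset.ne_of_mem_erase hj)
      have h2 : (starRingEnd ℂ) (q k - q j) ≠ 0 := (map_ne_zero _).2 h1
      have h3 : ((‖q k - q j‖ : ℂ)) ^ 2 = (q k - q j) * (starRingEnd ℂ) (q k - q j) := by
        rw [Complex.mul_conj, Complex.normSq_eq_norm_sq]; simp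
      have h4 : ((‖q j‖ : ℂ)) ^ 2 = q j * (starRingEnd ℂ) (q j) := by
        rw [Complex.mul_conj, Complex.normSq_eq_norm_sq]; simp
      rw [h3, h4, hconj]
      field_simp
  have hL0 : Lf m k q (q k) ≠ 0 := by
    intro h
    rw [h, mul_zero] at hLμ
    exact hμ.ne (by exact_mod_cast hLμ)
  have hμC : (μ : ℂ) ≠ 0 := by exact_mod_cast hμ.ne'
  refine ⟨2 / μ, by positivity, ?_⟩
  have cb : ∀ j, ContinuousAt (fun p : (Fin e → ℂ) × ℂ => p.1 j) (q, 0) := by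
    intro j; fun_prop
  have cbc : ∀ j, ContinuousAt (fun p : (Fin e → ℂ) × ℂ => (starRingEnd ℂ) (p.1 j)) (q, 0) := by
    intro j; exact Complex.continuous_conj.continuousAt.comp (cb j)
  have cn : ContinuousAt (fun p : (Fin e → ℂ) × ℂ => (‖p.1 k‖ : ℂ)) (q, 0) :=
    Complex.continuous_ofReal.continuousAt.comp (cb k).norm
  have hn0 : ((‖q k‖ : ℝ) : ℂ) ≠ 0 := by rw [hqk]; simp
  have cu : ContinuousAt (fun p : (Fin e → ℂ) × ℂ => uf k p.1) (q, 0) := (cb k).div cn hn0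
  have cZ : ContinuousAt (fun p : (Fin e → ℂ) × ℂ => Zf k p.1 p.2) (q, 0) :=
    cu.mul (continuousAt_const.sub continuousAt_snd)
  have c1 : ∀ j, ContinuousAt (fun p : (Fin e → ℂ) × ℂ => Zf k p.1 p.2 - p.1 j) (q, 0) :=
    fun j => cZ.sub (cb j)
  have c2 : ∀ j, ContinuousAt (fun p : (Fin e → ℂ) × ℂ =>
      1 - (starRingEnd ℂ) (p.1 j) * Zf k p.1 p.2) (q, 0) :=
    fun j => continuousAt_const.sub ((cbc j).mul cZ)
  have cL : ContinuousAt (fun p : (Fin e → ℂ) × ℂ => Lf m k p.1 (Zf k p.1 p.2)) (q, 0) := by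
    unfold Lf
    apply ContinuousAt.add
    · exact continuousAt_const.div cZ (by simpa [hZ] using hk0)
    · apply tendsto_finsetSum
      intro j hj
      have hj' := Finset.ne_of_mem_erase hj
      apply ContinuousAt.div (continuousAt_const.sub ((cb j).mul (cbc j))) ((c1 j).mul (c2 j))
      change (Zf k q 0 - q j) * (1 - (starRingEnd ℂ) (q j) * Zf k q 0) ≠ 0
      rw [hZ]
      exact mul_ne_zero (hne1 j hj') (hne2 j hj')
  have cH : ContinuousAt (fun p : (Fin e → ℂ) × ℂ => Hf m k p.1 p.2) (q, 0) := by
    unfold Hf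
    apply ContinuousAt.div _ cn hn0
    apply ContinuousAt.add
    · exact (continuousAt_const.sub cn).sub ((continuousAt_const.sub cn).mul continuousAt_snd)
    · apply ContinuousAt.div (continuousAt_const.add cn) (cu.mul cL)
      change uf k q * Lf m k q (Zf k q 0) ≠ 0
      rw [hZ, hu]
      exact mul_ne_zero hk0 hL0
  have hHq : Hf m k q 0 = ((2 / μ : ℝ) : ℂ) := by
    unfold Hf
    rw [hZ, hu, hLμ, hqk]
    push_cast
    norm_num
  have E1 := (cb k).eventually_ne hk0
  have E2 := cZ.eventually_ne (y := 0) (by simpa [hZ] using hk0)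
  have E3 : ∀ᶠ p : (Fin e → ℂ) × ℂ in nhds (q, 0), ∀ j, j ≠ k → Zf k p.1 p.2 - p.1 j ≠ 0 ∧
      1 - (starRingEnd ℂ) (p.1 j) * Zf k p.1 p.2 ≠ 0 := by
    rw [eventually_all]
    intro j
    by_cases hj : j = k
    · exact Eventually.of_forall fun p h => absurd hj h
    · have a1 := (c1 j).eventually_ne (y := 0) (by simpa only [hZ] using hne1 j hj)
      have a2 := (c2 j).eventually_ne (y := 0) (by simpa only [hZ] using hne2 j hj)
      filter_upwards [a1, a2] with p h1 h2 _ using ⟨h1, h2⟩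
  have E4 := cL.eventually_ne (y := 0) (by simpa only [hZ] using hL0)
  have E5 : ∀ᶠ p : (Fin e → ℂ) × ℂ in nhds (q, 0),
      ‖Hf m k p.1 p.2 - ((2 / μ : ℝ) : ℂ)‖ < (2 / μ) / 2 := by
    have c5 := (cH.sub (continuousAt_const (y := ((2 / μ : ℝ) : ℂ)))).norm
    apply c5.eventually_lt_const
    simp only [Pi.sub_apply, hHq, sub_self, norm_zero]
    positivity
  filter_upwards [E1, E2, E3, E4, E5] with p h1 h2 h3 h4 h5
  exact ⟨h1, ⟨h2, h3⟩, h4, h5⟩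

/-- In the degenerating setup, assume the boundary points `q k` (for
`d₁ ≤ k`) are pairwise distinct. Then for each boundary index `k` there is `ε₀ > 0`
such that for every `ε ∈ (0, ε₀)` there is `N` such that for all `n ≥ N`, the derivative
`(B n)'` has exactly one zero `c` in `{z ∈ 𝔻 : |z − q k| < ε}`, and this zero is simple. -/
theorem stmt11 (m e d₁ : ℕ) (hm : 1 ≤ m) (he : 1 ≤ e) (hd : d₁ < e)
    (q : Fin e → ℂ)
    (hqin : ∀ k : Fin e, (k : ℕ) < d₁ → ‖q k‖ < 1)
    (hqbd : ∀ k : Fin e, d₁ ≤ (k : ℕ) → ‖q k‖ = 1)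
    (A : ℕ → Fin e → ℂ)
    (hA : ∀ n k, ‖A n k‖ < 1)
    (hAconv : ∀ k, Tendsto (fun n => A n k) atTop (nhds (q k)))
    (hdist : ∀ k k' : Fin e, d₁ ≤ (k : ℕ) → d₁ ≤ (k' : ℕ) → q k = q k' → k = k')
    (k : Fin e) (hk : d₁ ≤ (k : ℕ)) :
    ∃ ε₀ > (0 : ℝ), ∀ ε : ℝ, 0 < ε → ε < ε₀ → ∃ N : ℕ, ∀ n ≥ N,
      ∃ c : ℂ, (‖c‖ < 1 ∧ ‖c - q k‖ < ε ∧ deriv (blaschke m (A n)) c = 0 ∧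
          deriv (deriv (blaschke m (A n))) c ≠ 0) ∧
        ∀ c' : ℂ, ‖c'‖ < 1 → ‖c' - q k‖ < ε → deriv (blaschke m (A n)) c' = 0 → c' = c := by
  have hq : ∀ j, ‖q j‖ ≤ 1 := by
    intro j
    rcases lt_or_ge (j : ℕ) d₁ with h | h
    · exact (hqin j h).le
    · exact (hqbd j h).le
  have hqk := hqbd k hk
  have hne : ∀ j ≠ k, q k ≠ q j := by
    intro j hj h
    rcases lt_or_ge (j : ℕ) d₁ with h1 | h1
    · have := hqin j h1
      rw [← h, hqk] at this
      exact lt_irrefl _ this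
    · exact hj (hdist k j hk h1 h).symm
  have hk0 : q k ≠ 0 := norm_ne_zero_iff.1 (by rw [hqk]; norm_num)
  obtain ⟨ν, hν, hev⟩ := local_facts m hm k q hq hqk hne
  obtain ⟨ρ, hρ, hball⟩ := Metric.eventually_nhds_iff.1 hev
  have hloc : ∀ b : Fin e → ℂ, dist b q < ρ → ∀ s : ℂ, ‖s‖ < ρ →
      b k ≠ 0 ∧ Good k b (Zf k b s) ∧ Lf m k b (Zf k b s) ≠ 0 ∧ ‖Hf m k b s - ν‖ < ν / 2 := by
    intro b hb s hs
    apply hball (y := (b, s))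
    rw [Prod.dist_eq]
    exact max_lt hb (by simpa using hs)
  have hAq : Tendsto A atTop (nhds q) := tendsto_pi_nhds.2 hAconv
  have hE1 : ∀ᶠ n in atTop, dist (A n) q < ρ := hAq.eventually (Metric.ball_mem_nhds q hρ)
  have hE2 : Tendsto (fun n => uf k (A n)) atTop (nhds (q k)) := by
    have h1 : Tendsto (fun n => (‖A n k‖ : ℂ)) atTop (nhds ((‖q k‖ : ℝ) : ℂ)) :=
      (Complex.continuous_ofReal.tendsto _).comp (hAconv k).norm
    have h2 := (hAconv k).div h1 (by rw [hqk]; simp)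
    rw [hqk] at h2
    rw [Complex.ofReal_one, div_one] at h2
    exact h2
  have hE3 : Tendsto (fun n => 1 - ‖A n k‖) atTop (nhds 0) := by
    have := (hAconv k).norm.const_sub 1
    rwa [hqk, sub_self] at this
  refine ⟨ρ / 4, by positivity, ?_⟩
  intro ε hε hερ
  obtain ⟨T, hT, hcore⟩ := core2 ν ρ (ε / 2) hν hρ (by positivity) (by linarith)
  have hE4 : ∀ᶠ n in atTop, ‖uf k (A n) - q k‖ < ε / 2 := by
    have := hE2.eventually (Metric.ball_mem_nhds (q k) (half_pos hε))
    filter_upwards [this] with n hn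
    simpa [dist_eq_norm] using hn
  have hE5 := hE3.eventually_lt_const hT
  obtain ⟨N, hN⟩ := eventually_atTop.1 (hE1.and (hE4.and hE5))
  refine ⟨N, ?_⟩
  intro n hn
  obtain ⟨hn1, hn2, hn3⟩ := hN n hn
  have hb := hA n
  have hl := hloc (A n) hn1
  have h0 : A n k ≠ 0 := (hl 0 (by simpa using hρ)).1
  have hun := uf_norm k (A n) h0
  have hu0 : uf k (A n) ≠ 0 := norm_ne_zero_iff.1 (by rw [hun]; norm_num)
  have hgood : ∀ s, ‖s‖ < ρ → Good k (A n) (Zf k (A n) s) ∧ Lf m k (A n) (Zf k (A n) s) ≠ 0 :=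
    fun s hs => ⟨(hl s hs).2.1, (hl s hs).2.2.1⟩
  obtain ⟨c, hc1, hc2, hc3, hc4, hc5⟩ := hcore (1 - ‖A n k‖) (by linarith [hb k]) hn3
    (Hf m k (A n)) (fun s hs => Hf_diff m k (A n) h0 s (hgood s hs).1 (hgood s hs).2)
    (fun s hs => (hl s hs).2.2.2)
  have hcρ : ‖c‖ < ρ := by linarith
  have hZn : ∀ s, ‖Zf k (A n) s‖ = ‖1 - s‖ := by
    intro s
    unfold Zf; rw [norm_mul, hun, one_mul]
  have hZu : ∀ s, ‖Zf k (A n) s - uf k (A n)‖ = ‖s‖ := by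
    intro s
    have : Zf k (A n) s - uf k (A n) = uf k (A n) * (-s) := by unfold Zf; ring
    rw [this, norm_mul, hun, one_mul, norm_neg]
  refine ⟨Zf k (A n) c, ⟨?_, ?_, ?_, ?_⟩, ?_⟩
  · rw [hZn]; exact hc2
  · have h1 := norm_sub_le_norm_sub_add_norm_sub (Zf k (A n) c) (uf k (A n)) (q k)
    rw [hZu] at h1
    linarith
  · rw [bridge m k (A n) hb h0 c hc2 (hgood c hcρ).1 (hgood c hcρ).2, hc3, mul_zero]
  · exact deriv2_ne m k (A n) hb h0 ρ hgood c hcρ hc2 hc3 hc4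
  · intro z hz1 hz2 hz3
    obtain ⟨s, rfl⟩ : ∃ s, z = Zf k (A n) s := by
      refine ⟨1 - z / uf k (A n), ?_⟩
      unfold Zf
      field_simp
      ring
    have hs1 : ‖1 - s‖ < 1 := by rw [← hZn]; exact hz1
    have hs2 : ‖s‖ < ρ / 2 := by
      have h1 := norm_sub_le_norm_sub_add_norm_sub (Zf k (A n) s) (q k) (uf k (A n))
      rw [hZu, norm_sub_rev (q k)] at h1
      linarith
    have hsρ : ‖s‖ < ρ := by linarith
    rw [bridge m k (A n) hb h0 s hs1 (hgood s hsρ).1 (hgood s hsρ).2] at hz3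
    have h2 := (mul_eq_zero.1 hz3).resolve_left
      (Qf_ne m k (A n) hb h0 s hs1 (hgood s hsρ).1 (hgood s hsρ).2)
    rw [hc5 s hs2 hs1 h2]
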